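/- Let v, H : ℝ × U → ℝ³ and p : ℝ × U → ℝ be smooth and satisfy the ideal MHD momentum equation D_t v + ∇p = (H·∇)H pointwise on ℝ × U. Then the matrix vorticity satisfies the transport identity D_t(curl v) = (∇H)ᵀ(curl H) + (curl H)(∇H) + (H·∇)(curl H) − (∇v)ᵀ(curl v) − (curl v)(∇v) pointwise on ℝ × U. -/

import Mathlib

/-- Spatial partial derivative `∂_j f` of a scalar function on `ℝ × ℝ³`. -/
noncomputable def pdx (j : Fin 3) (f : ℝ × (Fin 3 → ℝ) → ℝ) (p : ℝ × (Fin 3 → ℝ)) : ℝ :=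
  fderiv ℝ f p (0, Pi.single j 1)

/-- Time partial derivative `∂_t f` of a scalar function on `ℝ × ℝ³`. -/
noncomputable def pdt (f : ℝ × (Fin 3 → ℝ) → ℝ) (p : ℝ × (Fin 3 → ℝ)) : ℝ :=
  fderiv ℝ f p (1, 0)

/-- Material derivative `D_t f = ∂_t f + vᵏ ∂_k f` along the velocity field `v`. -/
noncomputable def Dt (v : ℝ × (Fin 3 → ℝ) → Fin 3 → ℝ) (f : ℝ × (Fin 3 → ℝ) → ℝ)
    (p : ℝ × (Fin 3 → ℝ)) : ℝ :=
  pdt f p + ∑ k : Fin 3, v p k * pdx k f p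

section PartialDerivatives

variable {f g : ℝ × (Fin 3 → ℝ) → ℝ} {q : ℝ × (Fin 3 → ℝ)}

lemma pdx_add (j : Fin 3) (hf : DifferentiableAt ℝ f q) (hg : DifferentiableAt ℝ g q) :
    pdx j (fun r => f r + g r) q = pdx j f q + pdx j g q := by
  simp only [pdx, fderiv_fun_add hf hg, add_apply]

lemma pdx_sub (j : Fin 3) (hf : DifferentiableAt ℝ f q) (hg : DifferentiableAt ℝ g q) :
    pdx j (fun r => f r - g r) q = pdx j f q - pdx j g q := by
  simp only [pdx, fderiv_fun_sub hf hg, sub_apply]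

lemma pdt_sub (hf : DifferentiableAt ℝ f q) (hg : DifferentiableAt ℝ g q) :
    pdt (fun r => f r - g r) q = pdt f q - pdt g q := by
  simp only [pdt, fderiv_fun_sub hf hg, sub_apply]

lemma Dt_sub (v : ℝ × (Fin 3 → ℝ) → Fin 3 → ℝ)
    (hf : DifferentiableAt ℝ f q) (hg : DifferentiableAt ℝ g q) :
    Dt v (fun r => f r - g r) q = Dt v f q - Dt v g q := by
  simp only [Dt, pdt_sub hf hg, pdx_sub _ hf hg, mul_sub, Finset.sum_sub_distrib]
  ring

lemma differentiableAt_fderiv_apply (hf : ContDiffAt ℝ 2 f q) (e : ℝ × (Fin 3 → ℝ)) :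
    DifferentiableAt ℝ (fun r => fderiv ℝ f r e) q :=
  ((hf.fderiv_right (m := 1) (by norm_num)).differentiableAt (by norm_num)).clm_apply
    (differentiableAt_const e)

lemma differentiableAt_pdx (hf : ContDiffAt ℝ 2 f q) (j : Fin 3) :
    DifferentiableAt ℝ (pdx j f) q :=
  differentiableAt_fderiv_apply hf _

lemma differentiableAt_pdt (hf : ContDiffAt ℝ 2 f q) : DifferentiableAt ℝ (pdt f) q :=
  differentiableAt_fderiv_apply hf _

lemma fderiv_fderiv_apply_comm (hf : ContDiffAt ℝ 2 f q) (d e : ℝ × (Fin 3 → ℝ)) :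
    fderiv ℝ (fun r => fderiv ℝ f r e) q d = fderiv ℝ (fun r => fderiv ℝ f r d) q e := by
  have hd := (hf.fderiv_right (m := 1) (by norm_num)).differentiableAt (by norm_num)
  have hs : IsSymmSndFDerivAt ℝ f q := hf.isSymmSndFDerivAt (by simp)
  rw [fderiv_clm_apply hd (differentiableAt_const e),
    fderiv_clm_apply hd (differentiableAt_const d)]
  simpa using hs d e

lemma pdx_pdx_comm (hf : ContDiffAt ℝ 2 f q) (j k : Fin 3) :
    pdx j (pdx k f) q = pdx k (pdx j f) q :=
  fderiv_fderiv_apply_comm hf _ _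

lemma pdx_pdt_comm (hf : ContDiffAt ℝ 2 f q) (j : Fin 3) :
    pdx j (pdt f) q = pdt (pdx j f) q :=
  fderiv_fderiv_apply_comm hf _ _

variable {a : ℝ × (Fin 3 → ℝ) → Fin 3 → ℝ}

lemma differentiableAt_advection (ha : DifferentiableAt ℝ a q) (hf : ContDiffAt ℝ 2 f q) :
    DifferentiableAt ℝ (fun r => ∑ k : Fin 3, a r k * pdx k f r) q :=
  DifferentiableAt.fun_sum fun k _ =>
    (differentiableAt_pi.1 ha k).mul (differentiableAt_pdx hf k)

lemma pdx_advection (ha : DifferentiableAt ℝ a q) (hf : ContDiffAt ℝ 2 f q) (j : Fin 3) :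
    pdx j (fun r => ∑ k : Fin 3, a r k * pdx k f r) q
      = (∑ k : Fin 3, a q k * pdx k (pdx j f) q)
        + ∑ k : Fin 3, pdx j (fun r => a r k) q * pdx k f q := by
  have hak := differentiableAt_pi.1 ha
  have hfk := differentiableAt_pdx hf
  rw [pdx, fderiv_fun_sum fun k _ => (hak k).fun_mul (hfk k), sum_apply,
    ← Finset.sum_add_distrib]
  refine Finset.sum_congr rfl fun k _ => ?_
  rw [fderiv_fun_mul (hak k) (hfk k), ← pdx_pdx_comm hf j k]
  simp only [pdx, add_apply, smul_apply, smul_eq_mul]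
  ring

lemma differentiableAt_Dt (ha : DifferentiableAt ℝ a q) (hf : ContDiffAt ℝ 2 f q) :
    DifferentiableAt ℝ (Dt a f) q :=
  (differentiableAt_pdt hf).add (differentiableAt_advection ha hf)

/-- The commutator of a spatial derivative with the material derivative. -/
lemma pdx_Dt (ha : DifferentiableAt ℝ a q) (hf : ContDiffAt ℝ 2 f q) (j : Fin 3) :
    pdx j (Dt a f) q
      = Dt a (pdx j f) q + ∑ k : Fin 3, pdx j (fun r => a r k) q * pdx k f q := by
  have h := pdx_add j (differentiableAt_pdt hf) (differentiableAt_advection ha hf)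
  rw [pdx_advection ha hf, pdx_pdt_comm hf] at h
  rw [Dt, add_assoc]
  exact h

end PartialDerivatives

/-- If D_t v + ∇p = (H·∇)H, then the matrix vorticity satisfies
D_t(curl v) = (∇H)ᵀ(curl H) + (curl H)(∇H) + (H·∇)(curl H)
              − (∇v)ᵀ(curl v) − (curl v)(∇v), componentwise. -/
theorem Dt_curl_v_transport (U : Set (Fin 3 → ℝ)) (hU : IsOpen U)
    (v H : ℝ × (Fin 3 → ℝ) → Fin 3 → ℝ) (p : ℝ × (Fin 3 → ℝ) → ℝ)
    (hv : ContDiffOn ℝ (⊤ : ℕ∞) v (Set.univ ×ˢ U))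
    (hH : ContDiffOn ℝ (⊤ : ℕ∞) H (Set.univ ×ˢ U))
    (hp : ContDiffOn ℝ (⊤ : ℕ∞) p (Set.univ ×ˢ U))
    (hmom : ∀ t : ℝ, ∀ x ∈ U, ∀ i : Fin 3,
      Dt v (fun r => v r i) (t, x) + pdx i p (t, x)
        = ∑ k : Fin 3, H (t, x) k * pdx k (fun r => H r i) (t, x)) :
    ∀ t : ℝ, ∀ x ∈ U, ∀ i j : Fin 3,
      Dt v (fun q => pdx j (fun r => v r i) q - pdx i (fun r => v r j) q) (t, x)
      = (∑ k : Fin 3, pdx i (fun r => H r k) (t, x) *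
            (pdx j (fun r => H r k) (t, x) - pdx k (fun r => H r j) (t, x)))
        + (∑ k : Fin 3, (pdx k (fun r => H r i) (t, x) - pdx i (fun r => H r k) (t, x)) *
            pdx j (fun r => H r k) (t, x))
        + (∑ k : Fin 3, H (t, x) k *
            pdx k (fun q => pdx j (fun r => H r i) q - pdx i (fun r => H r j) q) (t, x))
        - (∑ k : Fin 3, pdx i (fun r => v r k) (t, x) *
            (pdx j (fun r => v r k) (t, x) - pdx k (fun r => v r j) (t, x)))
        - ∑ k : Fin 3, (pdx k (fun r => v r i) (t, x) - pdx i (fun r => v r k) (t, x)) *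
            pdx j (fun r => v r k) (t, x) := by
  intro t x hx i j
  have hopen : IsOpen ((Set.univ : Set ℝ) ×ˢ U) := isOpen_univ.prod hU
  have hmem : (Set.univ : Set ℝ) ×ˢ U ∈ nhds (t, x) := hopen.mem_nhds ⟨Set.mem_univ t, hx⟩
  have h2 : (2 : WithTop ℕ∞) ≤ ((⊤ : ℕ∞) : WithTop ℕ∞) :=
    WithTop.coe_le_coe.2 (le_top : (2 : ℕ∞) ≤ ⊤)
  have hv2 := (hv.contDiffAt hmem).of_le h2
  have hH2 := (hH.contDiffAt hmem).of_le h2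
  have hp2 := (hp.contDiffAt hmem).of_le h2
  have hvi := contDiffAt_pi.1 hv2
  have hHi := contDiffAt_pi.1 hH2
  have hvd := hv2.differentiableAt (by norm_num)
  have hHd := hH2.differentiableAt (by norm_num)
  have hmom_pdx (i j : Fin 3) :
      Dt v (pdx j fun r => v r i) (t, x)
          + (∑ k : Fin 3, pdx j (fun r => v r k) (t, x) * pdx k (fun r => v r i) (t, x))
          + pdx j (pdx i p) (t, x)
        = (∑ k : Fin 3, H (t, x) k * pdx k (pdx j fun r => H r i) (t, x))
          + ∑ k : Fin 3, pdx j (fun r => H r k) (t, x) * pdx k (fun r => H r i) (t, x) := by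
    have heq : (fun q => Dt v (fun r => v r i) q + pdx i p q) =ᶠ[nhds (t, x)]
        fun q => ∑ k : Fin 3, H q k * pdx k (fun r => H r i) q := by
      filter_upwards [hmem] with q hq using hmom q.1 q.2 hq.2 i
    rw [← pdx_Dt hvd (hvi i), ← pdx_advection hHd (hHi i),
      ← pdx_add j (differentiableAt_Dt hvd (hvi i)) (differentiableAt_pdx hp2 i)]
    exact DFunLike.congr_fun (heq.fderiv_eq (𝕜 := ℝ)) (0, Pi.single j 1)
  have hij := hmom_pdx i j
  have hji := hmom_pdx j i
  rw [pdx_pdx_comm hp2 i j] at hji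
  rw [Dt_sub v (differentiableAt_pdx (hvi i) j) (differentiableAt_pdx (hvi j) i)]
  simp only [pdx_sub _ (differentiableAt_pdx (hHi i) j) (differentiableAt_pdx (hHi j) i)]
  simp only [Fin.sum_univ_three] at hij hji ⊢
  linear_combination hij - hji
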